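/- Let n ≥ 2 and 1 ≤ j ≤ n+1, let b_i = (b_{i1},…,b_{ii}) ∈ ℚ^i for 1 ≤ i ≤ j−1 and d_{q−1} (with rational entries) for j ≤ q ≤ n be given, and assume the ring R^{(B_(n),D_(n))}(j) is Artinian (finite dimensional over ℝ). Then the classes w^{(j)}_m := ∏_{i=1}^{n} β^{(j)}_{i,2n+1−i}·β^{(j)}_{i,2n−i}···β^{(j)}_{i,2n+1−i−m_i+1}, indexed by tuples m = (m_1,…,m_n) with 0 ≤ m_i ≤ 2(n−i)+1 (an empty product being 1), form a basis of R^{(B_(n),D_(n))}(j) as an ℝ-vector space. -/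

import Mathlib

open MvPolynomial

noncomputable section

/-- The variable `x_k` (1-indexed) of `ℝ[x_1,…,x_n]`. -/
def xv (n : ℕ) (k : ℕ) : MvPolynomial (Fin n) ℝ :=
  if h : 1 ≤ k ∧ k ≤ n then X ⟨k - 1, by omega⟩ else 0

/-- The type `D_m` root label `α^{D_m}_{i,k}` with variables given by `x`. -/
def alD {R : Type*} [CommRing R] (x : ℕ → R) (m i k : ℕ) : R :=
  if i = m then x (2 * m - k) + x m
  else if k ≤ m then x i - x k
  else x i + x (2 * m - k)

/-- `g^{b_i}_{i,2n+1−i} = Σ_{k=1}^{i} b_{ik}·(x_k²−x_{i+1}²)···(x_k²−x_n²)·x_k²`. -/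
def gBsq (n : ℕ) (b : ℕ → ℕ → ℚ) (i : ℕ) : MvPolynomial (Fin n) ℝ :=
  ∑ k ∈ Finset.Icc 1 i,
    (b i k : ℝ) • ((∏ ℓ ∈ Finset.Icc (i + 1) n, (xv n k ^ 2 - xv n ℓ ^ 2)) * xv n k ^ 2)

/-- `f^{d_i}_{i,2n−1−i} = Σ_{k=1}^{i} d_{ik}·(x_k²−x_{i+1}²)···(x_k²−x_n²)
 + (−1)^{n−i+1}·p_i·x_{i+1}²···x_n²` for `i ≥ 1`, with `f^{d_0}_{0,2n−1} = x_1²···x_n²`. -/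
def fDd (n : ℕ) (d : ℕ → ℕ → ℚ) (p : ℕ → ℚ) (i : ℕ) : MvPolynomial (Fin n) ℝ :=
  if i = 0 then ∏ ℓ ∈ Finset.Icc 1 n, xv n ℓ ^ 2
  else
    (∑ k ∈ Finset.Icc 1 i,
        (d i k : ℝ) • ∏ ℓ ∈ Finset.Icc (i + 1) n, (xv n k ^ 2 - xv n ℓ ^ 2)) +
      ((-1 : ℝ) ^ (n - i + 1) * (p i : ℝ)) • ∏ ℓ ∈ Finset.Icc (i + 1) n, xv n ℓ ^ 2

/-- The defining ideal of `R^{(B_(n),D_(n))}(j)`: generated by `g^{b_p}_{p,2n+1−p}` for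
`1 ≤ p ≤ j−1` together with `f^{d_{q−1}}_{q−1,2n−1−(q−1)}` for `j ≤ q ≤ n`. -/
def IBD (n : ℕ) (b : ℕ → ℕ → ℚ) (d : ℕ → ℕ → ℚ) (p : ℕ → ℚ) (j : ℕ) :
    Ideal (MvPolynomial (Fin n) ℝ) :=
  Ideal.span
    ((fun i => gBsq n b i) '' Set.Icc 1 (j - 1) ∪
      (fun q => fDd n d p (q - 1)) '' Set.Icc j n)

/-- `β^{(j)}_{i,k} = α^{D_{n+1}}_{i,k}(x_1,…,x_{j−1},0,x_j,…,x_n)`, the type `D_{n+1}`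
root label with `0` inserted in position `j`. -/
def betaJ (n j i k : ℕ) : MvPolynomial (Fin n) ℝ :=
  alD (fun t => if t < j then xv n t else if t = j then 0 else xv n (t - 1)) (n + 1) i k

/-- The class `w^{(j)}_m = ∏_{i=1}^{n} β^{(j)}_{i,2n+1−i}···β^{(j)}_{i,2n+1−i−m_i+1}`
in `R^{(B_(n),D_(n))}(j)`. -/
def wBD (n : ℕ) (b : ℕ → ℕ → ℚ) (d : ℕ → ℕ → ℚ) (p : ℕ → ℚ) (j : ℕ)
    (m : (i : Fin n) → Fin (2 * (n - (i.val + 1)) + 1 + 1)) :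
    MvPolynomial (Fin n) ℝ ⧸ IBD n b d p j :=
  Ideal.Quotient.mk (IBD n b d p j)
    (∏ i : Fin n, ∏ t ∈ Finset.range (m i : ℕ),
      betaJ n j (i.val + 1) (2 * n + 1 - (i.val + 1) - t))

/-- The exponent vectors `a ∈ ℕⁿ` of weighted degree `∑ dᵢ aᵢ` at most `k`, for positive
weights `d`. -/
def weightedSimplex {n : ℕ} (d : Fin n → ℕ) (k : ℕ) : Finset (Fin n → ℕ) :=
  {a ∈ Fintype.piFinset fun _ => Finset.range (k + 1) | ∑ i, d i * a i ≤ k}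

theorem mem_weightedSimplex {n : ℕ} {d : Fin n → ℕ} (hd : ∀ i, 1 ≤ d i) {k : ℕ}
    {a : Fin n → ℕ} : a ∈ weightedSimplex d k ↔ ∑ i, d i * a i ≤ k := by
  simp only [weightedSimplex, Finset.mem_filter, Fintype.mem_piFinset, Finset.mem_range,
    and_iff_right_iff_imp]
  intro h i
  have h1 : d i * a i ≤ ∑ i, d i * a i :=
    Finset.single_le_sum (f := fun i => d i * a i) (fun _ _ => Nat.zero_le _) (Finset.mem_univ i)
  have h2 : 1 * a i ≤ d i * a i := Nat.mul_le_mul_right _ (hd i)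
  omega

theorem prod_mul_card_weightedSimplex_le {n : ℕ} {d : Fin n → ℕ} (hd : ∀ i, 1 ≤ d i) (k : ℕ) :
    (∏ i, d i) * (weightedSimplex d k).card ≤
      (weightedSimplex (1 : Fin n → ℕ) (k + ∑ i, d i)).card := by
  have hcard : (∏ i, d i) = (Fintype.piFinset fun i => Finset.range (d i)).card := by
    simp [Fintype.card_piFinset]
  rw [hcard, ← Finset.card_product]
  refine Finset.card_le_card_of_injOn (fun ra i => ra.1 i + d i * ra.2 i) ?_ ?_
  · rintro ⟨r, a⟩ h
    simp only [Finset.coe_product, Set.mem_prod, Finset.mem_coe, Fintype.mem_piFinset,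
      Finset.mem_range, mem_weightedSimplex hd] at h
    simp only [Finset.mem_coe]
    rw [mem_weightedSimplex (d := 1) (fun _ => le_rfl)]
    simp only [Pi.one_apply, one_mul, Finset.sum_add_distrib]
    have := Finset.sum_le_sum (fun i (_ : i ∈ Finset.univ) => (h.1 i).le)
    omega
  · rintro ⟨r, a⟩ h ⟨r', a'⟩ h' heq
    simp only [Finset.coe_product, Set.mem_prod, Finset.mem_coe, Fintype.mem_piFinset,
      Finset.mem_range] at h h'
    have key : ∀ i, r i = r' i ∧ a i = a' i := by
      intro i
      have e := congrFun heq i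
      simp only at e
      have e1 := congrArg (· % d i) e
      have e2 := congrArg (· / d i) e
      simp only [Nat.add_mul_mod_self_left, Nat.mod_eq_of_lt (h.1 i),
        Nat.mod_eq_of_lt (h'.1 i)] at e1
      simp only [Nat.add_mul_div_left _ _ (hd i), Nat.div_eq_of_lt (h.1 i),
        Nat.div_eq_of_lt (h'.1 i), zero_add] at e2
      exact ⟨e1, e2⟩
    exact Prod.ext (funext fun i => (key i).1) (funext fun i => (key i).2)

/-- The number of lattice points in a dilated simplex grows subexponentially. -/
theorem le_of_mul_card_weightedSimplex_le {n s D D' : ℕ}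
    (h : ∀ k, D * (weightedSimplex (1 : Fin n → ℕ) k).card ≤
      D' * (weightedSimplex (1 : Fin n → ℕ) (k + s)).card) : D ≤ D' := by
  by_contra! hlt
  have hpos : 0 < (weightedSimplex (1 : Fin n → ℕ) 0).card := by
    refine Finset.card_pos.mpr ⟨0, ?_⟩
    rw [mem_weightedSimplex (d := 1) (fun _ => le_rfl)]
    simp
  have hD' : 0 < D' := by
    rcases Nat.eq_zero_or_pos D' with h0 | h0
    · have := h 0
      rw [h0, zero_mul] at this
      have := Nat.mul_pos (show 0 < D by omega) hpos
      omega
    · exact h0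
  have hub : ∀ k, (weightedSimplex (1 : Fin n → ℕ) k).card ≤ (k + 1) ^ n := by
    intro k
    refine (Finset.card_filter_le _ _).trans ?_
    simp [Fintype.card_piFinset]
  have hlb : ∀ k, D ^ k ≤ D' ^ k * (weightedSimplex (1 : Fin n → ℕ) (k * s)).card := by
    intro k
    induction k with
    | zero => simpa using hpos
    | succ k ih =>
      calc D ^ (k + 1) = D * D ^ k := pow_succ' _ _
        _ ≤ D * (D' ^ k * (weightedSimplex (1 : Fin n → ℕ) (k * s)).card) :=
          Nat.mul_le_mul_left _ ih
        _ = D' ^ k * (D * (weightedSimplex (1 : Fin n → ℕ) (k * s)).card) := by ring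
        _ ≤ D' ^ k * (D' * (weightedSimplex (1 : Fin n → ℕ) (k * s + s)).card) :=
          Nat.mul_le_mul_left _ (h _)
        _ = _ := by rw [add_one_mul]; ring
  set r : ℝ := D / D' with hr
  have hD'r : (0 : ℝ) < D' := by exact_mod_cast hD'
  have hr1 : 1 < r := by
    rw [hr, one_lt_div hD'r]
    exact_mod_cast hlt
  have hgrow : ∀ k : ℕ, r ^ k ≤ ((k : ℝ) * s + 1) ^ n := by
    intro k
    rw [hr, div_pow, div_le_iff₀ (by positivity)]
    have := (hlb k).trans (Nat.mul_le_mul_left _ (hub (k * s)))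
    rw [mul_comm]
    exact_mod_cast this
  have hlim := (tendsto_pow_const_div_const_pow_of_one_lt n hr1).const_mul (((s : ℝ) + 1) ^ n)
  rw [mul_zero] at hlim
  obtain ⟨k, hk1, hk2⟩ := ((hlim.eventually (gt_mem_nhds one_pos)).and
    (Filter.eventually_ge_atTop 1)).exists
  have hk1' : ((k : ℝ) * s + 1) ^ n ≤ ((s : ℝ) + 1) ^ n * (k : ℝ) ^ n := by
    rw [← mul_pow]
    have : (1 : ℝ) ≤ k := by exact_mod_cast hk2
    gcongr
    nlinarith
  rw [← mul_div_assoc, div_lt_one (by positivity)] at hk1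
  linarith [hgrow k]

theorem homogeneousComponent_mul_of_isHomogeneous {σ : Type*} {q f : MvPolynomial σ ℝ} {e : ℕ}
    (hf : f.IsHomogeneous e) (k : ℕ) :
    homogeneousComponent k (q * f) =
      if e ≤ k then homogeneousComponent (k - e) q * f else 0 := by
  conv_lhs => rw [← sum_homogeneousComponent q, Finset.sum_mul, map_sum]
  have hterm : ∀ i, homogeneousComponent k (homogeneousComponent i q * f) =
      if i + e = k then homogeneousComponent i q * f else 0 := by
    intro i
    rw [homogeneousComponent_of_mem ((homogeneousComponent_isHomogeneous i q).mul hf)]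
    simp only [eq_comm]
  simp_rw [hterm]
  split_ifs with hek
  · by_cases hk : k - e ∈ Finset.range (q.totalDegree + 1)
    · rw [Finset.sum_eq_single_of_mem _ hk, if_pos (by omega)]
      intro i _ hi
      rw [if_neg (by omega)]
    · rw [homogeneousComponent_eq_zero (k - e) q (by rw [Finset.mem_range] at hk; omega), zero_mul]
      refine Finset.sum_eq_zero fun i hi => if_neg ?_
      rintro rfl
      simp at hk hi
      omega
  · exact Finset.sum_eq_zero fun i _ => if_neg (by omega)

/-- Graded Nakayama: homogeneous elements spanning the quotient by homogeneous `fᵢ` generate the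
polynomial ring as a module over `ℝ[f₁, …, fₙ]`, with a degree bound. -/
theorem mem_span_mul_prod_pow {n : ℕ} {κ : Type*} [Fintype κ] {f : Fin n → MvPolynomial (Fin n) ℝ}
    {d : Fin n → ℕ} (hd : ∀ i, 1 ≤ d i) (hf : ∀ i, (f i).IsHomogeneous (d i))
    {E : κ → MvPolynomial (Fin n) ℝ} {e : κ → ℕ} (hE : ∀ s, (E s).IsHomogeneous (e s))
    (hspan : ∀ p, ∃ c : κ → ℝ, p - ∑ s, c s • E s ∈ Ideal.span (Set.range f))
    (k : ℕ) {p : MvPolynomial (Fin n) ℝ} (hp : p.IsHomogeneous k) :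
    p ∈ Submodule.span ℝ (Set.range fun sa : κ × weightedSimplex d k =>
      E sa.1 * ∏ i, f i ^ (sa.2 : Fin n → ℕ) i) := by
  induction k using Nat.strong_induction_on generalizing p with
  | _ k ih =>
  obtain ⟨c, hc⟩ := hspan p
  obtain ⟨q, hq⟩ := Ideal.mem_span_range_iff_exists_fun.mp hc
  have hpq : p = ∑ s, c s • homogeneousComponent k (E s) +
      ∑ i, homogeneousComponent k (q i * f i) := by
    have := congrArg (homogeneousComponent k) (show p = ∑ s, c s • E s + ∑ i, q i * f i by
      rw [hq]; ring)
    rw [homogeneousComponent_eq_self hp] at this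
    simpa only [map_add, map_sum, map_smul] using this
  rw [hpq]
  refine Submodule.add_mem _ (Submodule.sum_mem _ fun s _ => Submodule.smul_mem _ _ ?_)
    (Submodule.sum_mem _ fun i _ => ?_)
  · rw [homogeneousComponent_of_mem (hE s)]
    split_ifs
    · refine Submodule.subset_span ⟨⟨s, 0, ?_⟩, ?_⟩
      · rw [mem_weightedSimplex hd]; simp
      · simp
    · exact Submodule.zero_mem _
  · rw [homogeneousComponent_mul_of_isHomogeneous (hf i)]
    split_ifs with hik
    · have hmem := ih (k - d i) (by have := hd i; omega)
        (homogeneousComponent_isHomogeneous (k - d i) (q i))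
      have := Submodule.mem_map_of_mem (f := LinearMap.mulRight ℝ (f i)) hmem
      rw [LinearMap.mulRight_apply, Submodule.map_span] at this
      refine Submodule.span_le.mpr ?_ this
      rintro _ ⟨_, ⟨⟨s, a, ha⟩, rfl⟩, rfl⟩
      refine Submodule.subset_span ⟨⟨s, a + Pi.single i 1, ?_⟩, ?_⟩
      · rw [mem_weightedSimplex hd] at ha ⊢
        simp only [Pi.add_apply, mul_add, Finset.sum_add_distrib, Pi.single_apply, mul_ite,
          mul_one, mul_zero, Finset.sum_ite_eq', Finset.mem_univ, if_true]
        omega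
      · have hsingle : ∏ x, f x ^ (Pi.single i 1 : Fin n → ℕ) x = f i := by
          simp [Pi.single_apply, pow_ite]
        simp only [Pi.add_apply, pow_add, Finset.prod_mul_distrib, hsingle,
          LinearMap.mulRight_apply, mul_assoc]
    · exact Submodule.zero_mem _

/-- Lower Bézout bound: `n` homogeneous forms of positive degrees `dᵢ` (possibly zero) in `n`
variables with finite-dimensional quotient have quotient of dimension at least `∏ dᵢ`. -/
theorem prod_degree_le_finrank_quotient {n : ℕ} {f : Fin n → MvPolynomial (Fin n) ℝ}
    {d : Fin n → ℕ} (hd : ∀ i, 1 ≤ d i) (hf : ∀ i, (f i).IsHomogeneous (d i))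
    [FiniteDimensional ℝ (MvPolynomial (Fin n) ℝ ⧸ Ideal.span (Set.range f))] :
    ∏ i, d i ≤ Module.finrank ℝ (MvPolynomial (Fin n) ℝ ⧸ Ideal.span (Set.range f)) := by
  set I := Ideal.span (Set.range f) with hI
  obtain ⟨κ, a, -, hspan, hli⟩ := exists_linearIndependent' ℝ
    (fun s : Fin n →₀ ℕ => (Ideal.Quotient.mkₐ ℝ I) (monomial s (1 : ℝ)))
  have := hli.finite
  cases nonempty_fintype κ
  have hcard := hli.fintype_card_le_finrank
  have htop : Submodule.span ℝ (Set.range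
      (fun s : Fin n →₀ ℕ => (Ideal.Quotient.mkₐ ℝ I) (monomial s (1 : ℝ)))) = ⊤ := by
    have h1 := (basisMonomials (Fin n) ℝ).span_eq
    have h2 := congrArg (Submodule.map (Ideal.Quotient.mkₐ ℝ I).toLinearMap) h1
    rw [Submodule.map_span, ← Set.range_comp, Submodule.map_top,
      LinearMap.range_eq_top.mpr (Ideal.Quotient.mkₐ_surjective ℝ I)] at h2
    rw [← h2]
    congr
  rw [htop] at hspan
  have hE : ∀ p, ∃ c : κ → ℝ, p - ∑ s, c s • monomial (a s) (1 : ℝ) ∈ I := by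
    intro p
    have hp : Ideal.Quotient.mkₐ ℝ I p ∈ (⊤ : Submodule ℝ _) := trivial
    rw [← hspan, Submodule.mem_span_range_iff_exists_fun] at hp
    obtain ⟨c, hc⟩ := hp
    refine ⟨c, ?_⟩
    rw [← Ideal.Quotient.eq_zero_iff_mem, ← Ideal.Quotient.mkₐ_eq_mk ℝ, map_sub, ← hc, map_sum]
    simp
  refine le_trans (le_of_mul_card_weightedSimplex_le (n := n) (s := ∑ i, d i) fun k => ?_) hcard
  have hbound : (weightedSimplex (1 : Fin n → ℕ) k).card ≤
      Fintype.card κ * (weightedSimplex d k).card := by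
    have hli' : LinearIndependent ℝ (fun b : weightedSimplex (1 : Fin n → ℕ) k =>
        monomial (Finsupp.equivFunOnFinite.symm (b : Fin n → ℕ)) (1 : ℝ)) := by
      have := (basisMonomials (Fin n) ℝ).linearIndependent.comp
        (fun b : weightedSimplex (1 : Fin n → ℕ) k => Finsupp.equivFunOnFinite.symm b.1)
        (Finsupp.equivFunOnFinite.symm.injective.comp Subtype.val_injective)
      simpa [Function.comp_def] using this
    have hle := linearIndependent_le_span_aux' _ hli' (Set.range
      fun sa : κ × weightedSimplex d k =>
        monomial (a sa.1) (1 : ℝ) * ∏ i, f i ^ (sa.2 : Fin n → ℕ) i) ?_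
    · have := hle.trans (Fintype.card_le_of_surjective _ Set.rangeFactorization_surjective)
      simpa using this
    · rintro _ ⟨⟨b, hb⟩, rfl⟩
      rw [mem_weightedSimplex (d := 1) (fun _ => le_rfl)] at hb
      have hdeg : (Finsupp.equivFunOnFinite.symm b).degree ≤ k := by
        simpa [Finsupp.degree_eq_sum] using hb
      have := mem_span_mul_prod_pow hd hf
        (fun s => isHomogeneous_monomial (1 : ℝ) (rfl : (a s).degree = _)) hE _
        (isHomogeneous_monomial (1 : ℝ) (rfl : (Finsupp.equivFunOnFinite.symm b).degree = _))
      refine Submodule.span_mono ?_ this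
      rintro _ ⟨⟨s, a, ha⟩, rfl⟩
      rw [mem_weightedSimplex hd] at ha
      exact ⟨⟨s, a, (mem_weightedSimplex hd).mpr (ha.trans hdeg)⟩, rfl⟩
  calc (∏ i, d i) * (weightedSimplex (1 : Fin n → ℕ) k).card
      ≤ (∏ i, d i) * (Fintype.card κ * (weightedSimplex d k).card) :=
        Nat.mul_le_mul_left _ hbound
    _ = Fintype.card κ * ((∏ i, d i) * (weightedSimplex d k).card) := by ring
    _ ≤ _ := Nat.mul_le_mul_left _ (prod_mul_card_weightedSimplex_le hd k)

/-- The linear factors of `∏_{ℓ > i} (y_i² - y_ℓ²)`: the labels of row `i`, read from right to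
left, followed by the factor `y_i + y_{n+1}` missing from that row. -/
def rowFactor {R : Type*} [CommRing R] (y : ℕ → R) (n i t : ℕ) : R :=
  if t < 2 * (n - i) + 1 then alD y (n + 1) i (2 * n + 1 - i - t) else y i + y (n + 1)

section rowFactor

variable {R : Type*} [CommRing R] (y : ℕ → R) {n i : ℕ}

theorem rowFactor_of_lt (hi : i ≤ n) {t : ℕ} (ht : t < n - i) :
    rowFactor y n i t = y i + y (i + 1 + t) := by
  rw [rowFactor, if_pos (by omega), alD, if_neg (by omega), if_neg (by omega)]
  congr 2
  omega

theorem rowFactor_of_le (hi : i ≤ n) {t : ℕ} (ht : t ≤ n - i) :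
    rowFactor y n i (n - i + t) = y i - y (n + 1 - t) := by
  rw [rowFactor, if_pos (by omega), alD, if_neg (by omega), if_pos (by omega)]
  congr 2
  omega

theorem rowFactor_eq (hi : i ≤ n) (t : ℕ) : ∃ s, i < s ∧ s ≤ n + 1 ∧
    (rowFactor y n i t = y i - y s ∨ rowFactor y n i t = y i + y s) := by
  rcases lt_or_ge t (n - i) with h | h
  · exact ⟨i + 1 + t, by omega, by omega, Or.inr (rowFactor_of_lt y hi h)⟩
  · rcases lt_or_ge t (2 * (n - i) + 1) with h' | h'
    · obtain ⟨u, rfl⟩ := Nat.exists_eq_add_of_le h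
      exact ⟨n + 1 - u, by omega, by omega, Or.inl (rowFactor_of_le y hi (by omega))⟩
    · exact ⟨n + 1, by omega, le_rfl, Or.inr (by rw [rowFactor, if_neg (by omega)])⟩

theorem prod_rowFactor (hi : i ≤ n) :
    ∏ t ∈ Finset.range (2 * (n - i) + 2), rowFactor y n i t =
      ∏ l ∈ Finset.Icc (i + 1) (n + 1), (y i ^ 2 - y l ^ 2) := by
  have hsub : ∏ l ∈ Finset.Ico (i + 1) (n + 2), (y i - y l) =
      ∏ t ∈ Finset.range (n - i + 1), (y i - y (n + 1 - t)) := by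
    rw [Finset.prod_Ico_eq_prod_range, show n + 2 - (i + 1) = n - i + 1 by omega,
      ← Finset.prod_range_reflect]
    refine Finset.prod_congr rfl fun t ht => ?_
    rw [Finset.mem_range] at ht
    congr 2
    omega
  have hadd : ∏ l ∈ Finset.Ico (i + 1) (n + 2), (y i + y l) =
      (∏ t ∈ Finset.range (n - i), (y i + y (i + 1 + t))) * (y i + y (n + 1)) := by
    rw [Finset.prod_Ico_eq_prod_range, show n + 2 - (i + 1) = n - i + 1 by omega,
      Finset.prod_range_succ, show i + 1 + (n - i) = n + 1 by omega]
  have hIcc : Finset.Icc (i + 1) (n + 1) = Finset.Ico (i + 1) (n + 2) := by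
    ext; simp; omega
  simp_rw [hIcc, sq_sub_sq, Finset.prod_mul_distrib, hsub, hadd]
  rw [Finset.prod_range_succ, show 2 * (n - i) + 1 = (n - i) + (n - i + 1) by omega,
    Finset.prod_range_add,
    Finset.prod_congr rfl fun t ht => rowFactor_of_lt y hi (Finset.mem_range.mp ht),
    Finset.prod_congr rfl fun t ht =>
      rowFactor_of_le y hi (Nat.lt_succ_iff.mp (Finset.mem_range.mp ht)),
    rowFactor, if_neg (by omega)]
  ring

theorem rowFactor_dvd (hi : i ≤ n) {t : ℕ} (ht : t < 2 * (n - i) + 2) :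
    rowFactor y n i t ∣ ∏ l ∈ Finset.Icc (i + 1) (n + 1), (y i ^ 2 - y l ^ 2) := by
  rw [← prod_rowFactor y hi]
  exact Finset.dvd_prod_of_mem _ (Finset.mem_range.mpr ht)

end rowFactor

/-- Modulo an ideal identifying every `y_k` with some `±y_s`, `s ≥ i`, the combination
`∑_{k ≤ i} c_k ∏_{ℓ > i} (y_k² - y_ℓ²)` collapses to its `i`-th term. -/
theorem exists_sub_smul_prod_mem {A : Type*} [CommRing A] [Algebra ℝ A] {y : ℕ → A} {n i : ℕ}
    {I : Ideal A}
    (hI : ∀ k, 1 ≤ k → k ≤ n + 1 → ∃ s, i ≤ s ∧ s ≤ n + 1 ∧ (y k - y s ∈ I ∨ y k + y s ∈ I))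
    (hi : i ≤ n) (c : ℕ → ℝ) :
    ∃ c' : ℝ, ∑ k ∈ Finset.Icc 1 i, c k • ∏ l ∈ Finset.Icc (i + 1) (n + 1), (y k ^ 2 - y l ^ 2) -
      c' • ∏ l ∈ Finset.Icc (i + 1) (n + 1), (y i ^ 2 - y l ^ 2) ∈ I := by
  have hterm : ∀ k ∈ Finset.Icc 1 i, ∃ e : ℝ,
      ∏ l ∈ Finset.Icc (i + 1) (n + 1), (y k ^ 2 - y l ^ 2) -
        e • ∏ l ∈ Finset.Icc (i + 1) (n + 1), (y i ^ 2 - y l ^ 2) ∈ I := by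
    intro k hk
    rw [Finset.mem_Icc] at hk
    obtain ⟨s, his, hs, hmem⟩ := hI k hk.1 (by omega)
    have hsq : y k ^ 2 - y s ^ 2 ∈ I := by
      rw [sq_sub_sq]
      rcases hmem with h | h
      · exact I.mul_mem_left _ h
      · exact I.mul_mem_right _ h
    rcases his.eq_or_lt with rfl | hlt
    · refine ⟨1, ?_⟩
      rw [one_smul, ← Ideal.Quotient.eq, map_prod, map_prod]
      refine Finset.prod_congr rfl fun l _ => ?_
      rw [Ideal.Quotient.eq]
      simpa using hsq
    · refine ⟨0, ?_⟩
      rw [zero_smul, sub_zero]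
      exact I.mem_of_dvd (Finset.dvd_prod_of_mem _ (Finset.mem_Icc.mpr ⟨hlt, hs⟩)) hsq
  choose! e he using hterm
  refine ⟨∑ k ∈ Finset.Icc 1 i, c k * e k, ?_⟩
  rw [Finset.sum_smul, ← Finset.sum_sub_distrib]
  refine Ideal.sum_mem _ fun k hk => ?_
  rw [mul_smul, ← smul_sub]
  exact Submodule.smul_of_tower_mem I (c k) (he k hk)

/-- The ideal generated by the first `r` of the forms `L` and by the forms `G_{r+1}, …, G_n`. -/
def mixedIdeal {n : ℕ} (G L : ℕ → MvPolynomial (Fin n) ℝ) (r : ℕ) :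
    Ideal (MvPolynomial (Fin n) ℝ) :=
  Ideal.span (Set.range fun i : Fin n => if i.val < r then L i else G (i.val + 1))

/-- The span of the products of initial segments of the rows after the `r`-th one. -/
def rowProductSpan {n : ℕ} (y : ℕ → MvPolynomial (Fin n) ℝ) (r : ℕ) :
    Submodule ℝ (MvPolynomial (Fin n) ℝ) :=
  Submodule.span ℝ {P | ∃ m : Fin n → ℕ, (∀ i, m i ≤ 2 * (n - (i.val + 1)) + 1) ∧
    (∀ i, i.val < r → m i = 0) ∧
    P = ∏ i, ∏ t ∈ Finset.range (m i), rowFactor y n (i.val + 1) t}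

theorem prod_mul_mem_rowProductSpan {n : ℕ} (y : ℕ → MvPolynomial (Fin n) ℝ) {r T : ℕ}
    (hr : r < n) (hT : T ≤ 2 * (n - (r + 1)) + 1) {w : MvPolynomial (Fin n) ℝ}
    (hw : w ∈ rowProductSpan y (r + 1)) :
    (∏ t ∈ Finset.range T, rowFactor y n (r + 1) t) * w ∈ rowProductSpan y r := by
  have := Submodule.mem_map_of_mem
    (f := LinearMap.mulLeft ℝ (∏ t ∈ Finset.range T, rowFactor y n (r + 1) t)) hw
  rw [LinearMap.mulLeft_apply, rowProductSpan, Submodule.map_span] at this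
  refine Submodule.span_le.mpr ?_ this
  rintro _ ⟨_, ⟨m, hm, hm0, rfl⟩, rfl⟩
  refine Submodule.subset_span ⟨Function.update m ⟨r, hr⟩ T, fun i => ?_, fun i hi => ?_, ?_⟩
  · by_cases h : i = ⟨r, hr⟩
    · subst h; simpa using hT
    · simpa [h] using hm i
  · rw [Function.update_of_ne (by rintro rfl; exact lt_irrefl _ hi)]
    exact hm0 i (by omega)
  · rw [LinearMap.mulLeft_apply, ← Finset.mul_prod_erase _ _ (Finset.mem_univ (⟨r, hr⟩ : Fin n)),
      ← Finset.mul_prod_erase Finset.univ (fun i => ∏ t ∈ Finset.range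
        (Function.update m ⟨r, hr⟩ T i), rowFactor y n (i.val + 1) t)
        (Finset.mem_univ (⟨r, hr⟩ : Fin n)), hm0 ⟨r, hr⟩ (by simp)]
    simp only [Function.update_self, Finset.range_zero, Finset.prod_empty, one_mul]
    congr 1
    refine Finset.prod_congr rfl fun i hi => ?_
    rw [Function.update_of_ne (Finset.ne_of_mem_erase hi)]

theorem finiteDimensional_quotient_of_le {A : Type*} [CommRing A] [Algebra ℝ A] {I J : Ideal A}
    (h : I ≤ J) [FiniteDimensional ℝ (A ⧸ I)] : FiniteDimensional ℝ (A ⧸ J) :=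
  Module.Finite.of_surjective (Ideal.Quotient.factorₐ ℝ h).toLinearMap
    (Ideal.Quotient.factor_surjective h)

/-- One of `n` homogeneous generators of an ideal of finite codimension in `n` variables is never
redundant. -/
theorem not_finiteDimensional_of_eq_zero {n : ℕ} {f : Fin n → MvPolynomial (Fin n) ℝ}
    {d : Fin n → ℕ} (hd : ∀ i, 1 ≤ d i) (hf : ∀ i, (f i).IsHomogeneous (d i)) {i₀ : Fin n}
    (h0 : f i₀ = 0) :
    ¬ FiniteDimensional ℝ (MvPolynomial (Fin n) ℝ ⧸ Ideal.span (Set.range f)) := by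
  intro hfin
  set D := Module.finrank ℝ (MvPolynomial (Fin n) ℝ ⧸ Ideal.span (Set.range f)) with hD
  have hd' : ∀ i, 1 ≤ Function.update d i₀ (D + 1) i := by
    intro i
    by_cases h : i = i₀
    · subst h; simp
    · simpa [h] using hd i
  have hle := prod_degree_le_finrank_quotient (f := f) hd' (fun i => by
    by_cases h : i = i₀
    · subst h
      rw [h0]
      exact isHomogeneous_zero _ _ _
    · simpa [h] using hf i)
  have hlow := Finset.single_le_prod' (f := Function.update d i₀ (D + 1)) (fun i _ => hd' i)
    (Finset.mem_univ i₀)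
  rw [Function.update_self] at hlow
  omega

theorem mem_mixedIdeal_sup_rowProductSpan {n j : ℕ} {y G : ℕ → MvPolynomial (Fin n) ℝ}
    (hy : ∀ k, (y k).IsHomogeneous 1) (hj1 : 1 ≤ j) (hjn : j ≤ n + 1) (hyj : y j = 0)
    (hX : ∀ i : Fin n, ∃ k, 1 ≤ k ∧ k ≤ n + 1 ∧ y k = X i)
    (hG : ∀ i, 1 ≤ i → i ≤ n → ∃ c : ℕ → ℝ, G i =
      ∑ k ∈ Finset.Icc 1 i, c k • ∏ l ∈ Finset.Icc (i + 1) (n + 1), (y k ^ 2 - y l ^ 2))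
    (hGhom : ∀ i, 1 ≤ i → i ≤ n → (G i).IsHomogeneous (2 * (n + 1 - i)))
    {r : ℕ} (hr : r ≤ n) (L : ℕ → MvPolynomial (Fin n) ℝ) (hL : ∀ i < r, (L i).IsHomogeneous 1)
    (hinv : ∀ k, 1 ≤ k → k ≤ n + 1 → ∃ s, r + 1 ≤ s ∧ s ≤ n + 1 ∧
      (y k - y s ∈ Ideal.span (L '' Set.Iio r) ∨ y k + y s ∈ Ideal.span (L '' Set.Iio r)))
    (hfin : FiniteDimensional ℝ (MvPolynomial (Fin n) ℝ ⧸ mixedIdeal G L r))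
    (p : MvPolynomial (Fin n) ℝ) :
    p ∈ (mixedIdeal G L r).restrictScalars ℝ ⊔ rowProductSpan y r := by
  have hgenL : ∀ {r : ℕ} {L : ℕ → MvPolynomial (Fin n) ℝ}, r ≤ n →
      Ideal.span (L '' Set.Iio r) ≤ mixedIdeal G L r := by
    intro r L hr
    rw [Ideal.span_le]
    rintro _ ⟨i, hi, rfl⟩
    have hi' : i < r := hi
    exact Ideal.subset_span ⟨⟨i, by omega⟩, by simp [hi']⟩
  obtain ⟨e, he⟩ : ∃ e, e = n - r := ⟨_, rfl⟩
  induction e generalizing r L p with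
  | zero =>
    obtain rfl : r = n := by omega
    have hlast : y (r + 1) ∈ mixedIdeal G L r := by
      obtain ⟨s, hs1, hs2, hs⟩ := hinv j hj1 hjn
      obtain rfl : s = r + 1 := by omega
      rw [hyj, zero_sub, zero_add, neg_mem_iff, or_self] at hs
      exact hgenL le_rfl hs
    have hXmem : ∀ i, X i ∈ mixedIdeal G L r := by
      intro i
      obtain ⟨k, hk1, hk2, hk⟩ := hX i
      obtain ⟨s, hs1, hs2, hs⟩ := hinv k hk1 hk2
      obtain rfl : s = r + 1 := by omega
      rw [← hk]
      rcases hs with hs | hs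
      · exact (Submodule.sub_mem_iff_left _ hlast).mp (hgenL le_rfl hs)
      · exact (Submodule.add_mem_iff_left _ hlast).mp (hgenL le_rfl hs)
    induction p using MvPolynomial.induction_on with
    | C a =>
      refine Submodule.mem_sup_right ?_
      have h1 : (1 : MvPolynomial (Fin r) ℝ) ∈ rowProductSpan y r :=
        Submodule.subset_span ⟨0, by simp, by simp, by simp⟩
      simpa [MvPolynomial.smul_eq_C_mul] using Submodule.smul_mem _ a h1
    | add p q hp hq => exact Submodule.add_mem _ hp hq
    | mul_X p i _ => exact Submodule.mem_sup_left (Ideal.mul_mem_left _ p (hXmem i))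
  | succ e ih =>
    have hrn : r < n := by omega
    set Λ := Ideal.span (L '' Set.Iio r) with hΛ
    set Q := ∏ l ∈ Finset.Icc (r + 1 + 1) (n + 1), (y (r + 1) ^ 2 - y l ^ 2) with hQ
    obtain ⟨c', hc'⟩ : ∃ c' : ℝ, G (r + 1) - c' • Q ∈ Λ := by
      obtain ⟨c, hc⟩ := hG (r + 1) (by omega) (by omega)
      rw [hc]
      exact exists_sub_smul_prod_mem hinv (by omega) c
    have hGmem : ∀ {r : ℕ} (L : ℕ → MvPolynomial (Fin n) ℝ) (i : ℕ), r ≤ i → i < n →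
        G (i + 1) ∈ mixedIdeal G L r := by
      intro r L i hi hin
      exact Ideal.subset_span ⟨⟨i, hin⟩, by simp [hi.not_gt]⟩
    have hc'0 : c' ≠ 0 := by
      rintro rfl
      rw [zero_smul, sub_zero] at hc'
      let f : Fin n → MvPolynomial (Fin n) ℝ := fun i =>
        if i.val < r then L i else if i.val = r then 0 else G (i.val + 1)
      let d : Fin n → ℕ := fun i => if i.val < r then 1 else 2 * (n - i.val)
      refine not_finiteDimensional_of_eq_zero (f := f) (d := d) (i₀ := ⟨r, hrn⟩) ?_ ?_ ?_ ?_
      · intro i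
        have := i.isLt
        simp only [d]
        split_ifs <;> omega
      · intro i
        have := i.isLt
        simp only [f, d]
        split_ifs with h1 h2
        · exact hL _ h1
        · exact isHomogeneous_zero _ _ _
        · simpa using hGhom (i.val + 1) (by omega) (by omega)
      · simp [f]
      · refine finiteDimensional_quotient_of_le (I := mixedIdeal G L r) ?_
        have hΛf : Λ ≤ Ideal.span (Set.range f) := by
          rw [hΛ, Ideal.span_le]
          rintro _ ⟨i, hi, rfl⟩
          have hi' : i < r := hi
          exact Ideal.subset_span ⟨⟨i, by omega⟩, by simp [f, hi']⟩
        rw [mixedIdeal, Ideal.span_le]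
        rintro _ ⟨i, rfl⟩
        by_cases h1 : i.val = r
        · simpa [h1] using hΛf hc'
        · exact Ideal.subset_span ⟨i, by simp [f, h1]⟩
    have hQmem : Q ∈ mixedIdeal G L r := by
      have h1 : c' • Q ∈ mixedIdeal G L r := by
        have := Submodule.sub_mem _ (hGmem L r le_rfl hrn) (hgenL hrn.le hc')
        simpa using this
      have := Submodule.smul_of_tower_mem (mixedIdeal G L r) c'⁻¹ h1
      rwa [smul_smul, inv_mul_cancel₀ hc'0, one_smul] at this
    have hstep : ∀ t < 2 * (n - (r + 1)) + 2, ∀ v, ∃ u ∈ mixedIdeal G L r, ∃ v',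
        ∃ w ∈ rowProductSpan y (r + 1), v = u + rowFactor y n (r + 1) t * v' + w := by
      intro t ht v
      set a := rowFactor y n (r + 1) t with ha
      obtain ⟨s', hs'1, hs'2, hs'⟩ := rowFactor_eq y (show r + 1 ≤ n by omega) t
      let L' := Function.update L r a
      have hL'lt : ∀ i < r, L' i = L i := fun i hi => Function.update_of_ne hi.ne _ _
      have hL'r : L' r = a := Function.update_self _ _ _
      have hΛΛ' : Λ ≤ Ideal.span (L' '' Set.Iio (r + 1)) := by
        rw [hΛ]
        refine Ideal.span_mono ?_
        rintro _ ⟨i, hi, rfl⟩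
        have hi' : i < r := hi
        exact ⟨i, Set.mem_Iio.mpr (by omega), hL'lt i hi'⟩
      have haΛ' : a ∈ Ideal.span (L' '' Set.Iio (r + 1)) :=
        Ideal.subset_span ⟨r, Set.mem_Iio.mpr (by omega), hL'r⟩
      have hGΛ' : G (r + 1) ∈ Ideal.span (L' '' Set.Iio (r + 1)) := by
        have h1 : Q ∈ Ideal.span (L' '' Set.Iio (r + 1)) :=
          Ideal.mem_of_dvd _ (rowFactor_dvd y (by omega) ht) haΛ'
        have := Submodule.add_mem _ (hΛΛ' hc')
          (Submodule.smul_of_tower_mem (Ideal.span (L' '' Set.Iio (r + 1))) c' h1)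
        simpa using this
      have hle : mixedIdeal G L r ≤ mixedIdeal G L' (r + 1) := by
        conv_lhs => rw [mixedIdeal]
        rw [Ideal.span_le]
        rintro _ ⟨i, rfl⟩
        simp only [SetLike.mem_coe]
        split_ifs with h1
        · exact hgenL (by omega) (hΛΛ' (Ideal.subset_span ⟨i, h1, rfl⟩))
        · rcases (not_lt.mp h1).eq_or_lt with h2 | h2
          · rw [← h2]
            exact hgenL (by omega) hGΛ'
          · exact hGmem L' i.val h2 i.isLt
      have hge : mixedIdeal G L' (r + 1) ≤ mixedIdeal G L r ⊔ Ideal.span {a} := by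
        conv_lhs => rw [mixedIdeal]
        rw [Ideal.span_le]
        rintro _ ⟨i, rfl⟩
        simp only [SetLike.mem_coe]
        split_ifs with h1
        · rcases (Nat.lt_succ_iff.mp h1).eq_or_lt with h2 | h2
          · rw [h2, hL'r]
            exact Ideal.mem_sup_right (Ideal.mem_span_singleton_self a)
          · rw [hL'lt _ h2]
            exact Ideal.mem_sup_left (hgenL hrn.le (Ideal.subset_span ⟨i, h2, rfl⟩))
        · exact Ideal.mem_sup_left (hGmem L i.val (by omega) i.isLt)
      have hv := ih (r := r + 1) (by omega) L' ?_ ?_ (finiteDimensional_quotient_of_le hle) v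
        (by omega)
      · obtain ⟨u', hu', w, hw, rfl⟩ := Submodule.mem_sup.mp hv
        obtain ⟨u, hu, z, hz, rfl⟩ := Submodule.mem_sup.mp (hge hu')
        obtain ⟨v', rfl⟩ := Ideal.mem_span_singleton'.mp hz
        exact ⟨u, hu, v', w, hw, by ring⟩
      · intro i hi
        rcases (Nat.lt_succ_iff.mp hi).eq_or_lt with rfl | h2
        · rw [hL'r]
          rcases hs' with h | h <;> rw [ha, h]
          · exact (hy _).sub (hy _)
          · exact (hy _).add (hy _)
        · rw [hL'lt i h2]
          exact hL i h2
      · intro k hk1 hk2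
        obtain ⟨s, hs1, hs2, hs⟩ := hinv k hk1 hk2
        have hs : y k - y s ∈ Ideal.span (L' '' Set.Iio (r + 1)) ∨
          y k + y s ∈ Ideal.span (L' '' Set.Iio (r + 1)) := hs.imp (hΛΛ' ·) (hΛΛ' ·)
        rcases hs1.eq_or_lt with rfl | hlt
        · refine ⟨s', hs'1, hs'2, ?_⟩
          rcases hs with hs | hs <;> rcases hs' with h | h <;> rw [ha, h] at haΛ'
          · exact Or.inl (by convert Submodule.add_mem _ hs haΛ' using 1; ring)
          · exact Or.inr (by convert Submodule.add_mem _ hs haΛ' using 1; ring)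
          · exact Or.inr (by convert Submodule.sub_mem _ hs haΛ' using 1; ring)
          · exact Or.inl (by convert Submodule.sub_mem _ hs haΛ' using 1; ring)
        · exact ⟨s, hlt, hs2, hs⟩
    have hpeel : ∀ T ≤ 2 * (n - (r + 1)) + 2, ∃ v,
        p - (∏ t ∈ Finset.range T, rowFactor y n (r + 1) t) * v ∈
          (mixedIdeal G L r).restrictScalars ℝ ⊔ rowProductSpan y r := by
      intro T
      induction T with
      | zero => exact fun _ => ⟨p, by simp⟩
      | succ T ihT =>
        intro hT
        obtain ⟨v, hv⟩ := ihT (by omega)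
        obtain ⟨u, hu, v', w, hw, rfl⟩ := hstep T (by omega) v
        refine ⟨v', ?_⟩
        have h1 : (∏ t ∈ Finset.range T, rowFactor y n (r + 1) t) * u ∈
            (mixedIdeal G L r).restrictScalars ℝ ⊔ rowProductSpan y r :=
          Submodule.mem_sup_left (Ideal.mul_mem_left _ _ hu)
        have h2 := Submodule.mem_sup_right (S := (mixedIdeal G L r).restrictScalars ℝ)
          (prod_mul_mem_rowProductSpan y hrn (T := T) (by omega) hw)
        have h3 := Submodule.add_mem _ hv (Submodule.add_mem _ h1 h2)
        convert h3 using 1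
        rw [Finset.prod_range_succ]
        ring
    obtain ⟨v, hv⟩ := hpeel _ le_rfl
    rw [prod_rowFactor y (by omega), ← hQ] at hv
    have h1 : Q * v ∈ (mixedIdeal G L r).restrictScalars ℝ ⊔ rowProductSpan y r :=
      Submodule.mem_sup_left (Ideal.mul_mem_right _ _ hQmem)
    simpa using Submodule.add_mem _ hv h1

@[to_additive]
theorem prod_Icc_eq_prod_skip_mul {M : Type*} [CommMonoid M] (φ : ℕ → M) {a j m : ℕ}
    (haj : a ≤ j) (hjm : j ≤ m + 1) :
    ∏ l ∈ Finset.Icc a (m + 1), φ l =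
      (∏ l ∈ Finset.Icc a m, φ (if l < j then l else l + 1)) * φ j := by
  rw [← Finset.Ico_add_one_right_eq_Icc, ← Finset.Ico_add_one_right_eq_Icc, ← Finset.prod_Ico_consecutive _ haj (by omega : j ≤ m + 1 + 1),
    ← Finset.prod_Ico_consecutive _ haj hjm, Finset.prod_eq_prod_Ico_succ_bot (a := j) (by omega),
    ← Finset.prod_Ico_add' φ j (m + 1) 1, mul_comm (φ j), ← mul_assoc]
  congr 2
  · refine Finset.prod_congr rfl fun l hl => ?_
    rw [if_pos (Finset.mem_Ico.mp hl).2]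
  · refine Finset.prod_congr rfl fun l hl => ?_
    rw [if_neg (Finset.mem_Ico.mp hl).1.not_gt]

/-- The sequence `x_1, …, x_{j-1}, 0, x_j, …, x_n`, indexed from `1`. -/
def insertedVar (n j t : ℕ) : MvPolynomial (Fin n) ℝ :=
  if t < j then xv n t else if t = j then 0 else xv n (t - 1)

/-- The generators of `IBD` in order: `g_i` for `i < j` and `f_{i-1}` for `i ≥ j`. -/
def defForm (n : ℕ) (b d : ℕ → ℕ → ℚ) (p : ℕ → ℚ) (j i : ℕ) : MvPolynomial (Fin n) ℝ :=
  if i < j then gBsq n b i else fDd n d p (i - 1)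

theorem isHomogeneous_xv (n k : ℕ) : (xv n k).IsHomogeneous 1 := by
  rw [xv]
  split_ifs
  · exact isHomogeneous_X _ _
  · exact isHomogeneous_zero _ _ _

theorem isHomogeneous_insertedVar (n j t : ℕ) : (insertedVar n j t).IsHomogeneous 1 := by
  rw [insertedVar]
  split_ifs
  · exact isHomogeneous_xv n t
  · exact isHomogeneous_zero _ _ _
  · exact isHomogeneous_xv n _

theorem insertedVar_self (n j : ℕ) : insertedVar n j j = 0 := by
  simp [insertedVar]

theorem insertedVar_skip (n j l : ℕ) : insertedVar n j (if l < j then l else l + 1) = xv n l := by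
  rw [insertedVar]
  split_ifs <;> first | rfl | omega

theorem exists_insertedVar_eq_X (n j : ℕ) (i : Fin n) :
    ∃ k, 1 ≤ k ∧ k ≤ n + 1 ∧ insertedVar n j k = X i := by
  refine ⟨if i.val + 1 < j then i.val + 1 else i.val + 1 + 1, ?_, ?_, ?_⟩
  · split_ifs <;> omega
  · split_ifs <;> omega
  · rw [insertedVar_skip, xv, dif_pos (by omega)]
    simp

theorem exists_defForm_eq (n : ℕ) (b d : ℕ → ℕ → ℚ) (p : ℕ → ℚ) {j : ℕ} (hj1 : 1 ≤ j)
    (hjn : j ≤ n + 1) (i : ℕ) (hi1 : 1 ≤ i) (hin : i ≤ n) :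
    ∃ c : ℕ → ℝ, defForm n b d p j i = ∑ k ∈ Finset.Icc 1 i, c k •
      ∏ l ∈ Finset.Icc (i + 1) (n + 1), (insertedVar n j k ^ 2 - insertedVar n j l ^ 2) := by
  rw [defForm]
  split_ifs with hij
  · refine ⟨fun k => b i k, Finset.sum_congr rfl fun k hk => ?_⟩
    have hk' := (Finset.mem_Icc.mp hk).2
    rw [prod_Icc_eq_prod_skip_mul _ (show i + 1 ≤ j from hij) hjn]
    simp_rw [insertedVar_skip, insertedVar_self]
    rw [show insertedVar n j k = xv n k from if_pos (by omega)]
    simp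
  · obtain ⟨i, rfl⟩ : ∃ i', i = i' + 1 := ⟨i - 1, by omega⟩
    have hprod : ∀ q : MvPolynomial (Fin n) ℝ,
        ∏ l ∈ Finset.Icc (i + 1 + 1) (n + 1), (q - insertedVar n j l ^ 2) =
          ∏ l ∈ Finset.Icc (i + 1) n, (q - xv n l ^ 2) := by
      intro q
      have hshift := Finset.prod_Ico_add' (fun l => q - insertedVar n j l ^ 2) (i + 1) (n + 1) 1
      rw [Finset.Ico_add_one_right_eq_Icc, Finset.Ico_add_one_right_eq_Icc] at hshift
      rw [← hshift]
      refine Finset.prod_congr rfl fun l hl => ?_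
      have hl' := (Finset.mem_Icc.mp hl).1
      rw [insertedVar, if_neg (by omega), if_neg (by omega), Nat.add_sub_cancel]
    have hzero : ∏ l ∈ Finset.Icc (i + 1) n, ((0 : MvPolynomial (Fin n) ℝ) ^ 2 - xv n l ^ 2) =
        (-1 : ℝ) ^ (n - i) • ∏ l ∈ Finset.Icc (i + 1) n, xv n l ^ 2 := by
      have : ∀ l, (0 : MvPolynomial (Fin n) ℝ) ^ 2 - xv n l ^ 2 = (-1 : ℝ) • xv n l ^ 2 := by
        intro l; simp
      simp_rw [this]
      rw [Finset.prod_smul]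
      simp
    simp_rw [hprod, Nat.add_sub_cancel]
    rcases Nat.eq_zero_or_pos i with rfl | hi
    · obtain rfl : j = 1 := by omega
      refine ⟨fun _ => (-1) ^ n, ?_⟩
      simp only [zero_add, Finset.Icc_self, Finset.sum_singleton, insertedVar_self] at hzero ⊢
      rw [hzero, smul_smul, fDd, if_pos rfl, Nat.sub_zero, ← mul_pow]
      simp
    · refine ⟨fun k => if k < j then d i k else if k = j then -p i else d i (k - 1), ?_⟩
      rw [sum_Icc_eq_sum_skip_add _ hj1 (by omega), insertedVar_self, hzero, fDd, if_neg (by omega)]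
      simp_rw [insertedVar_skip]
      congr 1
      · refine Finset.sum_congr rfl fun k _ => ?_
        congr 1
        split_ifs <;> first | rfl | omega
      · rw [if_neg (lt_irrefl j), if_pos trivial, smul_smul, pow_succ]
        congr 1
        ring

theorem isHomogeneous_defForm (n : ℕ) (b d : ℕ → ℕ → ℚ) (p : ℕ → ℚ) {j : ℕ} (hj1 : 1 ≤ j)
    (hjn : j ≤ n + 1) {i : ℕ} (hi1 : 1 ≤ i) (hin : i ≤ n) :
    (defForm n b d p j i).IsHomogeneous (2 * (n + 1 - i)) := by
  obtain ⟨c, hc⟩ := exists_defForm_eq n b d p hj1 hjn i hi1 hin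
  rw [hc]
  refine IsHomogeneous.sum _ _ _ fun k _ => ?_
  rw [smul_eq_C_mul]
  have hprod := IsHomogeneous.prod (Finset.Icc (i + 1) (n + 1))
    (fun l => insertedVar n j k ^ 2 - insertedVar n j l ^ 2) (fun _ => 2) fun l _ =>
      ((isHomogeneous_insertedVar n j k).pow 2).sub ((isHomogeneous_insertedVar n j l).pow 2)
  convert (isHomogeneous_C _ (c k)).mul hprod using 1
  simp [mul_comm]

theorem IBD_eq_mixedIdeal (n : ℕ) (b d : ℕ → ℕ → ℚ) (p : ℕ → ℚ) {j : ℕ} (hj1 : 1 ≤ j)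
    (hjn : j ≤ n + 1) : IBD n b d p j = mixedIdeal (defForm n b d p j) 0 0 := by
  refine congrArg Ideal.span (Set.ext fun P => ⟨?_, ?_⟩)
  · rintro (⟨i, ⟨hi1, hi2⟩, rfl⟩ | ⟨i, ⟨hi1, hi2⟩, rfl⟩)
    · refine ⟨⟨i - 1, by omega⟩, ?_⟩
      simp [defForm, show i - 1 + 1 = i by omega, show i < j by omega]
    · refine ⟨⟨i - 1, by omega⟩, ?_⟩
      simp [defForm, show i - 1 + 1 = i by omega, show ¬ i < j by omega]
  · rintro ⟨i, rfl⟩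
    have := i.isLt
    by_cases h : i.val + 1 < j
    · exact Or.inl ⟨i.val + 1, ⟨by omega, by omega⟩, by simp [defForm, h]⟩
    · exact Or.inr ⟨i.val + 1, ⟨by omega, by omega⟩, by simp [defForm, h]⟩

/-- **Proposition 5.22.** If `R^{(B_(n),D_(n))}(j)` is Artinian (`1 ≤ j ≤ n+1`), then the
classes `w^{(j)}_m` with `0 ≤ m_i ≤ 2(n−i)+1` form an ℝ-basis of
`R^{(B_(n),D_(n))}(j)`. -/
theorem stmt_12 (n : ℕ) (hn : 2 ≤ n) (b : ℕ → ℕ → ℚ) (d : ℕ → ℕ → ℚ) (p : ℕ → ℚ)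
    (j : ℕ) (hj1 : 1 ≤ j) (hjn : j ≤ n + 1)
    (hart : FiniteDimensional ℝ (MvPolynomial (Fin n) ℝ ⧸ IBD n b d p j)) :
    LinearIndependent ℝ (wBD n b d p j) ∧
      Submodule.span ℝ (Set.range (wBD n b d p j)) = ⊤ := by
  have hI : IBD n b d p j = mixedIdeal (defForm n b d p j) 0 0 :=
    IBD_eq_mixedIdeal n b d p hj1 hjn
  have hspan : Submodule.span ℝ (Set.range (wBD n b d p j)) = ⊤ := by
    refine eq_top_iff.mpr fun P _ => ?_
    obtain ⟨q, rfl⟩ := Ideal.Quotient.mk_surjective P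
    have hq := mem_mixedIdeal_sup_rowProductSpan (isHomogeneous_insertedVar n j) hj1 hjn
      (insertedVar_self n j) (exists_insertedVar_eq_X n j)
      (exists_defForm_eq n b d p hj1 hjn) (fun i => isHomogeneous_defForm n b d p hj1 hjn)
      (Nat.zero_le n) 0 (fun i hi => absurd hi (Nat.not_lt_zero i))
      (fun k hk1 hk2 => ⟨k, by omega, hk2, Or.inl (by simp)⟩) (hI ▸ hart) q
    rw [← hI] at hq
    obtain ⟨u, hu, w, hw, rfl⟩ := Submodule.mem_sup.mp hq
    rw [map_add, Ideal.Quotient.eq_zero_iff_mem.mpr hu, zero_add]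
    have hw' := Submodule.mem_map_of_mem
      (f := (Ideal.Quotient.mkₐ ℝ (IBD n b d p j)).toLinearMap) hw
    rw [rowProductSpan, Submodule.map_span] at hw'
    refine Submodule.span_le.mpr ?_ hw'
    rintro _ ⟨_, ⟨m, hm, -, rfl⟩, rfl⟩
    refine Submodule.subset_span ⟨fun i => ⟨m i, Nat.lt_succ_of_le (hm i)⟩, ?_⟩
    refine congrArg (Ideal.Quotient.mk _) (Finset.prod_congr rfl fun i _ =>
      Finset.prod_congr rfl fun t ht => ?_)
    have ht' : t < 2 * (n - (i.val + 1)) + 1 := (Finset.mem_range.mp ht).trans_le (hm i)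
    rw [rowFactor, if_pos ht']
    rfl
  refine ⟨linearIndependent_of_top_le_span_of_card_eq_finrank hspan.ge (le_antisymm ?_ ?_), hspan⟩
  · rw [hI, mixedIdeal] at hart ⊢
    refine le_trans (le_of_eq ?_) (prod_degree_le_finrank_quotient
      (d := fun i : Fin n => 2 * (n - i.val)) (fun i => ?_) fun i => ?_)
    · simp only [Fintype.card_pi, Fintype.card_fin]
      exact Finset.prod_congr rfl fun i _ => by omega
    · have := i.isLt
      omega
    · simpa using isHomogeneous_defForm n b d p hj1 hjn (i := i.val + 1) (by omega) i.isLt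
  · have := finrank_range_le_card (R := ℝ) (wBD n b d p j)
    rwa [Set.finrank, hspan, finrank_top] at this
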